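/- Let u : 𝔻 → ℂ and v : 𝔻 → 𝔻 be analytic functions, and define 𝒜_{u,v} f(z) = u(z)·conj(f(conj(v(z)))) for f ∈ H². Then 𝒜_{u,v} maps H² into H² and is a conjugation on H² if and only if one of the following holds: (i) there exist β, μ ∈ ℂ with |β| = |μ| = 1 such that u(z) = β and v(z) = μz for all z ∈ 𝔻; or (ii) there exist p ∈ 𝔻 \ {0} and β ∈ ℂ with |β| = 1 such that u(z) = β·√(1−|p|²)/(1 − pz) and v(z) = (p/conj(p))·(conj(p) − z)/(1 − pz) for all z ∈ 𝔻. -/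

import Mathlib

open scoped ComplexConjugate InnerProductSpace ENNReal NNReal
open Complex Metric

noncomputable section

abbrev H2 : Type := lp (fun _ : ℕ => ℂ) 2

namespace H2

/-- Evaluation of an element of `H²` (given by its sequence of Taylor coefficients)
at a point `z` of the unit disk: `f(z) = ∑ aₙ zⁿ`. -/
def eval (f : H2) (z : ℂ) : ℂ := ∑' n : ℕ, (f : ∀ _ : ℕ, ℂ) n * z ^ n

/-- The Szegő kernel function `K_w(z) = 1/(1 - conj w * z)`. -/
def ker (w z : ℂ) : ℂ := (1 - conj w * z)⁻¹

lemma kernel_memℓp (w : ℂ) (hw : ‖w‖ < 1) :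
    Memℓp (fun n : ℕ => (conj w) ^ n) 2 := by
  apply memℓp_gen
  have hsum : Summable (fun n : ℕ => (‖w‖ ^ 2) ^ n) :=
    summable_geometric_of_lt_one (by positivity) (by nlinarith [norm_nonneg w])
  refine hsum.congr fun n => ?_
  have h2 : ((2 : ℝ≥0∞).toReal) = ((2 : ℕ) : ℝ) := by simp
  rw [h2, Real.rpow_natCast]
  simp [norm_pow, ← pow_mul, Nat.mul_comm]

/-- The reproducing kernel of `H²` at `w` in the unit disk, as an element of `H²`. -/
def kernel (w : ℂ) : H2 :=
  if hw : ‖w‖ < 1 then ⟨fun n : ℕ => (conj w) ^ n, kernel_memℓp w hw⟩ else 0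

/-- `T` is the composition operator `C_φ` on `H²`. -/
def IsCompOp (φ : ℂ → ℂ) (T : H2 →L[ℂ] H2) : Prop :=
  ∀ f : H2, ∀ z : ℂ, ‖z‖ < 1 → eval (T f) z = eval f (φ z)

/-- `W` is the weighted composition operator `W_{ψ,φ}` on `H²`. -/
def IsWCompOp (ψ φ : ℂ → ℂ) (W : H2 →L[ℂ] H2) : Prop :=
  ∀ f : H2, ∀ z : ℂ, ‖z‖ < 1 → eval (W f) z = ψ z * eval f (φ z)

/-- A conjugation on `H²`: a conjugate-linear involution satisfying `⟪Cx, Cy⟫ = ⟪y, x⟫`. -/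
structure IsConjugation (C : H2 → H2) : Prop where
  map_add : ∀ x y : H2, C (x + y) = C x + C y
  map_smul : ∀ (c : ℂ) (x : H2), C (c • x) = conj c • C x
  invol : ∀ x : H2, C (C x) = x
  inner_conj : ∀ x y : H2, ⟪C x, C y⟫_ℂ = ⟪y, x⟫_ℂ

/-- `T` is `C`-normal: `C T* T C = T T*`. -/
def CNormal (C : H2 → H2) (T : H2 →L[ℂ] H2) : Prop :=
  ∀ x : H2, C ((ContinuousLinearMap.adjoint T) (T (C x)))
      = T ((ContinuousLinearMap.adjoint T) x)

/-- `T` is a normal operator: `T* T = T T*`. -/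
def IsNormalOp (T : H2 →L[ℂ] H2) : Prop :=
  (ContinuousLinearMap.adjoint T).comp T = T.comp (ContinuousLinearMap.adjoint T)

/-- `T` is a unitary operator. -/
def IsUnitaryOp (T : H2 →L[ℂ] H2) : Prop :=
  T.comp (ContinuousLinearMap.adjoint T) = ContinuousLinearMap.id ℂ H2 ∧
  (ContinuousLinearMap.adjoint T).comp T = ContinuousLinearMap.id ℂ H2

/-- `C` is the conjugation `J_μ` on `H²`: `(J_μ f)(z) = conj (f (μ * conj z))`. -/
def IsJmu (μ : ℂ) (C : H2 → H2) : Prop :=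
  ∀ f : H2, ∀ z : ℂ, ‖z‖ < 1 → eval (C f) z = conj (eval f (μ * conj z))

/-- `ξ_p(z) = √(1-|p|²) / (1 - conj p * z)`. -/
def xi (p z : ℂ) : ℂ := (Real.sqrt (1 - ‖p‖ ^ 2) : ℂ) / (1 - conj p * z)

/-- `τ_p(z) = λ (p - z) / (1 - conj p * z)`. -/
def tau (p lam z : ℂ) : ℂ := lam * (p - z) / (1 - conj p * z)

/-- `C` is the conjugation `J W_{ξ_p, τ_p}` on `H²`:
`(C f)(z) = conj (ξ_p(conj z) * f (τ_p (conj z)))`. -/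
def IsJW (p lam : ℂ) (C : H2 → H2) : Prop :=
  ∀ f : H2, ∀ z : ℂ, ‖z‖ < 1 →
    eval (C f) z = conj (xi p (conj z) * eval f (tau p lam (conj z)))

end H2

namespace H2

lemma one_sub_mul_ne_zero {a b : ℂ} (ha : ‖a‖ < 1) (hb : ‖b‖ < 1) : 1 - a * b ≠ 0 := by
  intro h
  have h1 : ‖a * b‖ = 1 := by rw [← sub_eq_zero.mp h, norm_one]
  rw [norm_mul] at h1
  nlinarith [norm_nonneg a, norm_nonneg b]

lemma eval_eq_inner (f : H2) {z : ℂ} (hz : ‖z‖ < 1) : eval f z = ⟪kernel z, f⟫_ℂ := by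
  rw [lp.inner_eq_tsum, eval, kernel, dif_pos hz]
  refine tsum_congr fun n => ?_
  simp

lemma hasSum_eval (f : H2) {z : ℂ} (hz : ‖z‖ < 1) :
    HasSum (fun n : ℕ => (f : ∀ _ : ℕ, ℂ) n * z ^ n) (eval f z) := by
  rw [eval_eq_inner f hz]
  refine (lp.hasSum_inner (kernel z) f).congr_fun fun n => ?_
  simp [kernel, hz]

lemma eval_sub (f g : H2) {z : ℂ} (hz : ‖z‖ < 1) : eval (f - g) z = eval f z - eval g z := by
  simp only [eval_eq_inner _ hz, inner_sub_right]

lemma eval_smul (c : ℂ) (f : H2) {z : ℂ} (hz : ‖z‖ < 1) : eval (c • f) z = c * eval f z := by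
  simp only [eval_eq_inner _ hz, inner_smul_right]

lemma eval_kernel {w z : ℂ} (hw : ‖w‖ < 1) (hz : ‖z‖ < 1) :
    eval (kernel w) z = (1 - conj w * z)⁻¹ := by
  rw [eval, kernel, dif_pos hw, ← tsum_geometric_of_norm_lt_one (ξ := conj w * z)]
  · exact tsum_congr fun n => (mul_pow _ _ _).symm
  · rw [norm_mul, RCLike.norm_conj]
    nlinarith [norm_nonneg w, norm_nonneg z]

lemma eval_single (n : ℕ) (c z : ℂ) : eval (lp.single 2 n c) z = c * z ^ n := by
  rw [eval, tsum_eq_single n]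
  · simp
  · intro m hm
    simp [hm]

lemma eval_star (f : H2) (z : ℂ) : eval (star f) z = conj (eval f (conj z)) := by
  simp [eval, conj_tsum]

/-- An element of `H²` is determined by its values on the unit disk. -/
lemma ext_eval {f g : H2} (h : ∀ z : ℂ, ‖z‖ < 1 → eval f z = eval g z) : f = g := by
  rw [← sub_eq_zero]
  set d : H2 := f - g
  have hd : ∀ z : ℂ, ‖z‖ < 1 → eval d z = 0 := fun z hz => by
    rw [eval_sub _ _ hz, h z hz, sub_self]
  have hp : HasFPowerSeriesAt (0 : ℂ → ℂ)
      (FormalMultilinearSeries.ofScalars ℂ (d : ∀ _ : ℕ, ℂ)) 0 := by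
    rw [hasFPowerSeriesAt_iff]
    filter_upwards [Metric.ball_mem_nhds (0 : ℂ) one_pos] with z hz
    have hz' : ‖z‖ < 1 := by simpa using hz
    have := hasSum_eval d hz'
    rw [hd z hz'] at this
    simpa [FormalMultilinearSeries.coeff_ofScalars, mul_comm] using this
  ext n
  rw [← FormalMultilinearSeries.coeff_ofScalars (𝕜 := ℂ) (p := (d : ∀ _ : ℕ, ℂ)) (n := n),
    hp.eq_zero]
  rfl

/-- An orthonormal sequence is the image of the monomials under an isometry of `H²`. -/
lemma exists_isometry_of_orthonormal {e : ℕ → H2} (he : Orthonormal ℂ e) :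
    ∃ T : H2 →ₗᵢ[ℂ] H2, ∀ f : H2, ∀ z : ℂ, ‖z‖ < 1 →
      eval (T f) z = ∑' n : ℕ, (f : ∀ _ : ℕ, ℂ) n * eval (e n) z := by
  refine ⟨he.orthogonalFamily.linearIsometry, fun f z hz => ?_⟩
  have h := (he.orthogonalFamily.hasSum_linearIsometry f).mapL (innerSL ℂ (kernel z))
  rw [eval_eq_inner _ hz]
  refine (h.tsum_eq.symm.trans (tsum_congr fun n => ?_))
  simp [eval_eq_inner _ hz]

lemma exists_shift :
    ∃ S : H2 →ₗᵢ[ℂ] H2, ∀ f : H2, ∀ z : ℂ, ‖z‖ < 1 → eval (S f) z = z * eval f z := by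
  have he : Orthonormal ℂ (fun n : ℕ => (lp.single 2 (n + 1) (1 : ℂ) : H2)) := by
    rw [orthonormal_iff_ite]
    intro i j
    rw [lp.inner_single_left]
    by_cases hij : i = j
    · simp [hij]
    · simp [hij]
  obtain ⟨S, hS⟩ := exists_isometry_of_orthonormal he
  refine ⟨S, fun f z hz => ?_⟩
  rw [hS f z hz, eval, ← tsum_mul_left]
  refine tsum_congr fun n => ?_
  rw [eval_single]
  ring

/-- Multiplication by a Blaschke factor is an isometry of `H²`. -/
lemma exists_mul_blaschke {q l : ℂ} (hq : ‖q‖ < 1) (hl : ‖l‖ = 1) :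
    ∃ V : H2 →ₗᵢ[ℂ] H2, ∀ f : H2, ∀ z : ℂ, ‖z‖ < 1 →
      eval (V f) z = l * ((q - z) / (1 - conj q * z)) * eval f z := by
  obtain ⟨S, hS⟩ := exists_shift
  set S' : H2 →L[ℂ] H2 := S.toContinuousLinearMap
  have hS' : ∀ f, S' f = S f := fun f => rfl
  have hB : IsUnit (1 - conj q • S') := by
    apply isUnit_one_sub_of_norm_lt_one
    rw [norm_smul, RCLike.norm_conj]
    have := S.norm_toContinuousLinearMap_le
    nlinarith [norm_nonneg q, norm_nonneg S']
  obtain ⟨B, hB⟩ := hB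
  have hinv : ∀ f : H2, (↑B⁻¹ : H2 →L[ℂ] H2) f - conj q • S ((↑B⁻¹ : H2 →L[ℂ] H2) f) = f := by
    intro f
    have h := DFunLike.congr_fun B.mul_inv f
    rw [hB] at h
    simpa [hS'] using h
  have hnorm : ∀ h : H2, ‖q • h - S h‖ = ‖h - conj q • S h‖ := by
    intro h
    have h2 : ‖q • h - S h‖ ^ 2 = ‖h - conj q • S h‖ ^ 2 := by
      rw [@norm_sub_sq ℂ, @norm_sub_sq ℂ]
      simp only [norm_smul, inner_smul_left, inner_smul_right, LinearIsometry.norm_map,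
        RCLike.norm_conj]
      ring
    exact (sq_eq_sq₀ (norm_nonneg _) (norm_nonneg _)).mp h2
  refine ⟨⟨(l • (q • 1 - S') * (↑B⁻¹ : H2 →L[ℂ] H2) : H2 →L[ℂ] H2).toLinearMap, fun f => ?_⟩,
    fun f z hz => ?_⟩
  · have : (l • (q • 1 - S') * (↑B⁻¹ : H2 →L[ℂ] H2) : H2 →L[ℂ] H2) f
        = l • (q • (↑B⁻¹ : H2 →L[ℂ] H2) f - S ((↑B⁻¹ : H2 →L[ℂ] H2) f)) := rfl
    change ‖(l • (q • 1 - S') * (↑B⁻¹ : H2 →L[ℂ] H2) : H2 →L[ℂ] H2) f‖ = _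
    rw [this, norm_smul, hl, one_mul, hnorm, hinv]
  · change eval (l • (q • (↑B⁻¹ : H2 →L[ℂ] H2) f - S ((↑B⁻¹ : H2 →L[ℂ] H2) f))) z = _
    have hf := congrArg (fun g => eval g z) (hinv f)
    simp only [eval_smul _ _ hz, eval_sub _ _ hz, hS _ _ hz] at hf ⊢
    have hne : 1 - conj q * z ≠ 0 := one_sub_mul_ne_zero (by rwa [RCLike.norm_conj]) hz
    set x := eval ((↑B⁻¹ : H2 →L[ℂ] H2) f) z
    have hx : x - conj q * (z * x) = (1 - conj q * z) * x := by ring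
    rw [← hf, hx, ← mul_assoc, mul_assoc l, div_mul_cancel₀ _ hne]
    ring

/-- The orbit of a unit vector under an isometry is orthonormal as soon as the vector is
orthogonal to the range of the isometry. -/
lemma orthonormal_iterate (V : H2 →ₗᵢ[ℂ] H2) {e : H2} (he : ‖e‖ = 1)
    (hV : ∀ x, ⟪e, V x⟫_ℂ = 0) : Orthonormal ℂ (fun n : ℕ => V^[n] e) := by
  have hnorm : ∀ n : ℕ, ‖V^[n] e‖ = 1 := by
    intro n
    induction n with
    | zero => exact he
    | succ n ih => rw [Function.iterate_succ_apply', V.norm_map, ih]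
  have hlt : ∀ m k : ℕ, ⟪V^[m] e, V^[m + (k + 1)] e⟫_ℂ = 0 := by
    intro m k
    induction m with
    | zero => rw [zero_add, Function.iterate_succ_apply']; exact hV _
    | succ m ih =>
      rw [show m + 1 + (k + 1) = (m + (k + 1)) + 1 by ring, Function.iterate_succ_apply',
        Function.iterate_succ_apply', V.inner_map_map, ih]
  refine ⟨hnorm, fun m n hmn => ?_⟩
  rcases lt_or_gt_of_ne hmn with h | h
  · obtain ⟨k, rfl⟩ := Nat.exists_eq_add_of_lt h
    exact hlt m k
  · obtain ⟨k, rfl⟩ := Nat.exists_eq_add_of_lt h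
    exact inner_eq_zero_symm.mp (hlt n k)

lemma exists_isometry_weighted {q l β : ℂ} (hq : ‖q‖ < 1) (hl : ‖l‖ = 1) (hβ : ‖β‖ = 1)
    {u v : ℂ → ℂ}
    (hu : ∀ z : ℂ, ‖z‖ < 1 → u z = β * (Real.sqrt (1 - ‖q‖ ^ 2) : ℂ) / (1 - conj q * z))
    (hv : ∀ z : ℂ, ‖z‖ < 1 → v z = l * ((q - z) / (1 - conj q * z))) :
    ∃ T : H2 →ₗᵢ[ℂ] H2, ∀ f : H2, ∀ z : ℂ, ‖z‖ < 1 → eval (T f) z = u z * eval f (v z) := by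
  obtain ⟨V, hV⟩ := exists_mul_blaschke hq hl
  set e : H2 := (β * (Real.sqrt (1 - ‖q‖ ^ 2) : ℂ)) • kernel q with he
  have hpos : 0 < 1 - ‖q‖ ^ 2 := by nlinarith [norm_nonneg q]
  have hnorm : ‖e‖ = 1 := by
    have hk : ‖kernel q‖ ^ 2 = (1 - ‖q‖ ^ 2)⁻¹ := by
      have h := eval_eq_inner (kernel q) hq
      rw [eval_kernel hq hq, inner_self_eq_norm_sq_to_K, Complex.conj_mul'] at h
      apply Complex.ofReal_injective
      push_cast
      exact h.symm
    have h2 : ‖e‖ ^ 2 = 1 := by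
      rw [he, norm_smul, norm_mul, hβ, one_mul, mul_pow, hk, Complex.norm_real, Real.norm_eq_abs,
        sq_abs, Real.sq_sqrt hpos.le, mul_inv_cancel₀ hpos.ne']
    exact (pow_eq_one_iff_of_nonneg (norm_nonneg e) two_ne_zero).mp h2
  have horth : ∀ x, ⟪e, V x⟫_ℂ = 0 := by
    intro x
    rw [he, inner_smul_left, ← eval_eq_inner _ hq, hV x q hq]
    simp
  obtain ⟨T, hT⟩ := exists_isometry_of_orthonormal (orthonormal_iterate V hnorm horth)
  refine ⟨T, fun f z hz => ?_⟩
  have hpow : ∀ n : ℕ, eval (V^[n] e) z = u z * v z ^ n := by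
    intro n
    induction n with
    | zero => simp [he, eval_smul _ _ hz, eval_kernel hq hz, hu z hz, div_eq_mul_inv]
    | succ n ih =>
      rw [Function.iterate_succ_apply', hV _ z hz, ih, ← hv z hz]
      ring
  rw [hT f z hz, eval, ← tsum_mul_left]
  refine tsum_congr fun n => ?_
  rw [hpow]
  ring

lemma inner_star_star (f g : H2) : ⟪star f, star g⟫_ℂ = ⟪g, f⟫_ℂ := by
  rw [lp.inner_eq_tsum, lp.inner_eq_tsum]
  refine tsum_congr fun n => ?_
  simp [mul_comm]

lemma exists_conjugation {u v : ℂ → ℂ} (hvmap : ∀ z : ℂ, ‖z‖ < 1 → ‖v z‖ < 1)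
    (hT : ∃ T : H2 →ₗᵢ[ℂ] H2, ∀ f : H2, ∀ z : ℂ, ‖z‖ < 1 → eval (T f) z = u z * eval f (v z))
    (hu : ∀ z : ℂ, ‖z‖ < 1 → u z * conj (u (conj (v z))) = 1)
    (hv : ∀ z : ℂ, ‖z‖ < 1 → conj (v (conj (v z))) = z) :
    ∃ C : H2 → H2, IsConjugation C ∧
        ∀ f : H2, ∀ z : ℂ, ‖z‖ < 1 →
          eval (C f) z = u z * conj (eval f (conj (v z))) := by
  obtain ⟨T, hT⟩ := hT
  have hC : ∀ f : H2, ∀ z : ℂ, ‖z‖ < 1 →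
      eval (T (star f)) z = u z * conj (eval f (conj (v z))) := by
    intro f z hz
    rw [hT _ z hz, eval_star]
  refine ⟨fun f => T (star f), ⟨fun x y => ?_, fun c x => ?_, fun x => ?_, fun x y => ?_⟩, hC⟩
  · simp only [star_add, map_add]
  · simp only [star_smul, map_smul]
    rfl
  · refine ext_eval fun z hz => ?_
    rw [hC _ z hz, hC _ _ (by rw [RCLike.norm_conj]; exact hvmap z hz), map_mul, conj_conj,
      hv z hz, ← mul_assoc, hu z hz, one_mul]
  · rw [T.inner_map_map, inner_star_star]

/-- The weight and the symbol of a conjugation are linear fractional. -/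
lemma symbols_of_conjugation {u v : ℂ → ℂ} (hvmap : ∀ z : ℂ, ‖z‖ < 1 → ‖v z‖ < 1)
    {C : H2 → H2} (hC : IsConjugation C)
    (h : ∀ f : H2, ∀ z : ℂ, ‖z‖ < 1 → eval (C f) z = u z * conj (eval f (conj (v z)))) :
    ∃ a b c : ℂ, ‖a‖ < 1 ∧ (∀ z : ℂ, ‖z‖ < 1 →
      u z = c / (1 - a * z) ∧ v z = (a + b * z) / (1 - a * z)) := by
  have hCk : ∀ w z : ℂ, ‖w‖ < 1 → ‖z‖ < 1 → eval (C (kernel w)) z = u z * (1 - w * v z)⁻¹ := by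
    intro w z hw hz
    rw [h _ z hz, eval_kernel hw (by rw [RCLike.norm_conj]; exact hvmap z hz)]
    simp
  have hsymm : ∀ w z : ℂ, ‖w‖ < 1 → ‖z‖ < 1 →
      u z * (1 - w * v z)⁻¹ = u w * (1 - z * v w)⁻¹ := by
    intro w z hw hz
    rw [← hCk w z hw hz, ← hCk z w hz hw, eval_eq_inner _ hz, eval_eq_inner _ hw]
    conv_lhs => rw [← hC.invol (kernel z)]
    exact hC.inner_conj _ _
  have h0 : ‖(0 : ℂ)‖ < 1 := by simp
  have hu : ∀ z : ℂ, ‖z‖ < 1 → u z = u 0 / (1 - v 0 * z) := by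
    intro z hz
    have := hsymm 0 z h0 hz
    simpa [div_eq_mul_inv, mul_comm] using this
  have hu0 : u 0 ≠ 0 := by
    intro h00
    have h1 := h (C (kernel 0)) 0 h0
    rw [hC.invol, eval_kernel h0 h0, h00] at h1
    simp at h1
  have hhalf : ‖(1 / 2 : ℂ)‖ < 1 := by norm_num
  refine ⟨v 0, 2 * v (1 / 2) - v 0 * v (1 / 2) - 2 * v 0, u 0, hvmap 0 h0,
    fun z hz => ⟨hu z hz, ?_⟩⟩
  have hs := hsymm (1 / 2) z hhalf hz
  rw [hu z hz, hu (1 / 2) hhalf] at hs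
  have n1 : 1 - v 0 * z ≠ 0 := one_sub_mul_ne_zero (hvmap 0 h0) hz
  have n2 : 1 - v 0 * (1 / 2) ≠ 0 := one_sub_mul_ne_zero (hvmap 0 h0) hhalf
  have n3 : 1 - 1 / 2 * v z ≠ 0 := one_sub_mul_ne_zero hhalf (hvmap z hz)
  have n4 : 1 - z * v (1 / 2) ≠ 0 := one_sub_mul_ne_zero hz (hvmap _ hhalf)
  rw [← div_eq_mul_inv, ← div_eq_mul_inv, div_div, div_div,
    div_eq_div_iff (mul_ne_zero n1 n3) (mul_ne_zero n2 n4)] at hs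
  have hs' := mul_left_cancel₀ hu0 hs
  rw [eq_div_iff n1]
  linear_combination 2 * hs'

lemma weight_mul_conj_mul_eval {u v : ℂ → ℂ} (hvmap : ∀ z : ℂ, ‖z‖ < 1 → ‖v z‖ < 1)
    {C : H2 → H2} (hC : IsConjugation C)
    (h : ∀ f : H2, ∀ z : ℂ, ‖z‖ < 1 → eval (C f) z = u z * conj (eval f (conj (v z))))
    (f : H2) {z : ℂ} (hz : ‖z‖ < 1) :
    u z * conj (u (conj (v z))) * eval f (conj (v (conj (v z)))) = eval f z := by
  have h1 := h (C f) z hz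
  rw [hC.invol, h f _ (by rw [RCLike.norm_conj]; exact hvmap z hz)] at h1
  rw [h1, map_mul, conj_conj, mul_assoc]

lemma weight_mul_conj {u v : ℂ → ℂ} (hvmap : ∀ z : ℂ, ‖z‖ < 1 → ‖v z‖ < 1)
    {C : H2 → H2} (hC : IsConjugation C)
    (h : ∀ f : H2, ∀ z : ℂ, ‖z‖ < 1 → eval (C f) z = u z * conj (eval f (conj (v z))))
    {z : ℂ} (hz : ‖z‖ < 1) : u z * conj (u (conj (v z))) = 1 := by
  simpa [eval_single] using weight_mul_conj_mul_eval hvmap hC h (lp.single 2 0 1) hz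

lemma symbol_involutive {u v : ℂ → ℂ} (hvmap : ∀ z : ℂ, ‖z‖ < 1 → ‖v z‖ < 1)
    {C : H2 → H2} (hC : IsConjugation C)
    (h : ∀ f : H2, ∀ z : ℂ, ‖z‖ < 1 → eval (C f) z = u z * conj (eval f (conj (v z))))
    {z : ℂ} (hz : ‖z‖ < 1) : conj (v (conj (v z))) = z := by
  simpa [eval_single, weight_mul_conj hvmap hC h hz] using
    weight_mul_conj_mul_eval hvmap hC h (lp.single 2 1 1) hz

end H2

/-- Lemma 2.1: for analytic `u : 𝔻 → ℂ` and `v : 𝔻 → 𝔻`, the map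
`𝒜_{u,v} f (z) = u(z) conj (f (conj (v z)))` maps `H²` into `H²` and is a conjugation on `H²`
iff either `u ≡ β`, `v(z) = μ z` with `|β| = |μ| = 1`, or
`u(z) = β √(1-|p|²)/(1 - p z)`, `v(z) = (p / conj p)(conj p - z)/(1 - p z)` for some
`p ∈ 𝔻 \ {0}` and `|β| = 1`. -/
theorem stmt14 (u v : ℂ → ℂ)
    (hu : DifferentiableOn ℂ u (Metric.ball (0 : ℂ) 1))
    (hv : DifferentiableOn ℂ v (Metric.ball (0 : ℂ) 1))
    (hvmap : ∀ z : ℂ, ‖z‖ < 1 → ‖v z‖ < 1) :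
    (∃ C : H2 → H2, H2.IsConjugation C ∧
        ∀ f : H2, ∀ z : ℂ, ‖z‖ < 1 →
          H2.eval (C f) z = u z * conj (H2.eval f (conj (v z)))) ↔
      ((∃ β μ : ℂ, ‖β‖ = 1 ∧ ‖μ‖ = 1 ∧
          ∀ z : ℂ, ‖z‖ < 1 → u z = β ∧ v z = μ * z) ∨
        (∃ p β : ℂ, p ≠ 0 ∧ ‖p‖ < 1 ∧ ‖β‖ = 1 ∧
          ∀ z : ℂ, ‖z‖ < 1 →
            u z = β * (Real.sqrt (1 - ‖p‖ ^ 2) : ℂ) / (1 - p * z) ∧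
            v z = p / conj p * ((conj p - z) / (1 - p * z)))) := by
  constructor
  · rintro ⟨C, hC, h⟩
    obtain ⟨a, b, c, ha, hac⟩ := H2.symbols_of_conjugation hvmap hC h
    have hmul := @H2.weight_mul_conj u v hvmap C hC h
    have hfix := @H2.symbol_involutive u v hvmap C hC h
    have hrel : ∀ z : ℂ, ‖z‖ < 1 →
        c * conj c = 1 - conj a * a - (a + conj a * b) * z := by
      intro z hz
      have hvz : ‖conj (v z)‖ < 1 := by rw [RCLike.norm_conj]; exact hvmap z hz
      have n1 : 1 - a * z ≠ 0 := H2.one_sub_mul_ne_zero ha hz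
      have n2 : 1 - conj a * v z ≠ 0 :=
        H2.one_sub_mul_ne_zero (by rwa [RCLike.norm_conj]) (hvmap z hz)
      have h1 := hmul hz
      rw [(hac z hz).1, (hac _ hvz).1] at h1
      simp only [map_div₀, map_sub, map_mul, map_one, conj_conj] at h1
      rw [div_mul_div_comm, div_eq_one_iff_eq (mul_ne_zero n1 n2)] at h1
      have h2 : v z * (1 - a * z) = a + b * z := by rw [(hac z hz).2, div_mul_cancel₀ _ n1]
      linear_combination h1 - conj a * h2
    have hc : c * conj c = 1 - conj a * a := by simpa using hrel 0 (by simp)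
    have hb : a + conj a * b = 0 := by
      have := hrel (1 / 2) (by norm_num)
      linear_combination 2 * this - 2 * hc
    have hcn : ‖c‖ ^ 2 = 1 - ‖a‖ ^ 2 := by
      rw [Complex.mul_conj', Complex.conj_mul'] at hc
      exact_mod_cast hc
    by_cases ha0 : a = 0
    · subst ha0
      have hv' : ∀ z : ℂ, ‖z‖ < 1 → v z = b * z := fun z hz => by simpa using (hac z hz).2
      refine Or.inl ⟨c, b, ?_, ?_, fun z hz => ⟨by simpa using (hac z hz).1, hv' z hz⟩⟩
      · exact (pow_eq_one_iff_of_nonneg (norm_nonneg c) two_ne_zero).mp (by simpa using hcn)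
      · have hhalf : ‖(1 / 2 : ℂ)‖ < 1 := by norm_num
        have h1 := hfix hhalf
        rw [hv' _ (by rw [RCLike.norm_conj]; exact hvmap _ hhalf), hv' _ hhalf] at h1
        simp only [map_mul, conj_conj] at h1
        have h2 : conj b * b = 1 := by linear_combination 2 * h1
        rw [Complex.conj_mul'] at h2
        exact (pow_eq_one_iff_of_nonneg (norm_nonneg b) two_ne_zero).mp (by exact_mod_cast h2)
    · have hca : conj a ≠ 0 := (map_ne_zero _).mpr ha0
      have hpos : 0 < 1 - ‖a‖ ^ 2 := by nlinarith [norm_nonneg a]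
      have hs : (Real.sqrt (1 - ‖a‖ ^ 2) : ℂ) ≠ 0 :=
        Complex.ofReal_ne_zero.mpr (Real.sqrt_pos.mpr hpos).ne'
      refine Or.inr ⟨a, c / (Real.sqrt (1 - ‖a‖ ^ 2) : ℂ), ha0, ha, ?_, fun z hz => ⟨?_, ?_⟩⟩
      · rw [norm_div, Complex.norm_real, Real.norm_of_nonneg (Real.sqrt_nonneg _), ← hcn,
          Real.sqrt_sq (norm_nonneg c), div_self]
        intro h0
        rw [h0] at hcn
        nlinarith
      · rw [div_mul_cancel₀ _ hs]
        exact (hac z hz).1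
      · have hb' : b = -a / conj a := by
          rw [eq_div_iff hca]
          linear_combination hb
        rw [(hac z hz).2, hb', mul_div_assoc']
        congr 1
        field_simp
        ring
  · rintro (⟨β, μ, hβ, hμ, h⟩ | ⟨p, β, hp0, hp, hβ, h⟩)
    · have hββ : β * conj β = 1 := by rw [Complex.mul_conj', hβ]; norm_num
      have hμμ : conj μ * μ = 1 := by rw [Complex.conj_mul', hμ]; norm_num
      refine H2.exists_conjugation hvmap
        (H2.exists_isometry_weighted (q := 0) (l := -μ) (β := β) (by simp) (by simpa using hμ) hβ
          (fun z hz => by simp [(h z hz).1]) (fun z hz => by simp [(h z hz).2])) ?_ ?_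
      · intro z hz
        rw [(h z hz).1, (h _ (by rw [RCLike.norm_conj]; exact hvmap z hz)).1, hββ]
      · intro z hz
        rw [(h _ (by rw [RCLike.norm_conj]; exact hvmap z hz)).2, (h z hz).2]
        simp only [map_mul, conj_conj]
        linear_combination z * hμμ
    · have hcp : conj p ≠ 0 := (map_ne_zero _).mpr hp0
      have hcpn : ‖conj p‖ < 1 := by rwa [RCLike.norm_conj]
      have hpos : 0 < 1 - ‖p‖ ^ 2 := by nlinarith [norm_nonneg p]
      have hββ : β * conj β = 1 := by rw [Complex.mul_conj', hβ]; norm_num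
      have hss : (Real.sqrt (1 - ‖p‖ ^ 2) : ℂ) * (Real.sqrt (1 - ‖p‖ ^ 2) : ℂ)
          = 1 - p * conj p := by
        rw [← Complex.ofReal_mul, Real.mul_self_sqrt hpos.le, Complex.mul_conj']
        push_cast
        rfl
      have hne : 1 - p * conj p ≠ 0 := H2.one_sub_mul_ne_zero hp hcpn
      have hden : ∀ z : ℂ, ‖z‖ < 1 → 1 - conj p * v z = (1 - p * conj p) / (1 - p * z) := by
        intro z hz
        have n1 : 1 - p * z ≠ 0 := H2.one_sub_mul_ne_zero hp hz
        rw [(h z hz).2]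
        field_simp
        ring
      refine H2.exists_conjugation hvmap
        (H2.exists_isometry_weighted (q := conj p) (l := p / conj p) (β := β) hcpn ?_ hβ
          (fun z hz => by simpa using (h z hz).1) (fun z hz => by simpa using (h z hz).2)) ?_ ?_
      · rw [norm_div, RCLike.norm_conj, div_self (norm_ne_zero_iff.mpr hp0)]
      · intro z hz
        have n1 : 1 - p * z ≠ 0 := H2.one_sub_mul_ne_zero hp hz
        have hvz : ‖conj (v z)‖ < 1 := by rw [RCLike.norm_conj]; exact hvmap z hz
        rw [(h _ hvz).1, (h z hz).1]
        simp only [map_div₀, map_sub, map_mul, map_one, conj_conj, conj_ofReal]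
        rw [hden z hz, div_mul_div_comm, mul_div_cancel₀ _ n1, div_eq_one_iff_eq hne]
        linear_combination (Real.sqrt (1 - ‖p‖ ^ 2) : ℂ) * (Real.sqrt (1 - ‖p‖ ^ 2) : ℂ) * hββ + hss
      · intro z hz
        have n1 : 1 - p * z ≠ 0 := H2.one_sub_mul_ne_zero hp hz
        rw [(h _ (by rw [RCLike.norm_conj]; exact hvmap z hz)).2]
        simp only [map_div₀, map_sub, map_mul, map_one, conj_conj]
        have hne' : 1 - conj p * p ≠ 0 := by rwa [mul_comm]
        rw [hden z hz, (h z hz).2]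
        field_simp
        ring
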